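/- arXiv:2203.16290 — 2 statements merged into one kernel-verified Lean document; each statement's English description precedes it below -/
import Mathlib

section
/- Let f : ℝ^n × ℝ^m → ℝ^n be continuously differentiable, with x ↦ D_x f(x, u) Lipschitz continuous in x (uniformly for the fixed input considered). Suppose the discrete-time system x_{k+1} = f(x_k, u_k) is incrementally input-to-state stable (δISS) with an exponential KL bound: there exist ρ > 0, λ ∈ (0,1), and a class-𝒦∞ function γ such that for any two initial states x_{a,0}, x_{b,0} ∈ ℝ^n and any two input sequences u_{a,·}, u_{b,·} with values in the compact set 𝒰 ⊆ ℝ^m, the corresponding state trajectories satisfy ‖x_{a,k} − x_{b,k}‖₂ ≤ ρ ‖x_{a,0} − x_{b,0}‖₂ λ^k + γ( max_{0 ≤ t ≤ k} ‖u_{a,t} − u_{b,t}‖₂ ) for all k ≥ 0. Then for every equilibrium (x̄, ū) with ū ∈ 𝒰 and f(x̄, ū) = x̄, the Jacobian matrix A_δ = D_x f(x̄, ū) ∈ ℝ^{n×n} is Schur stable, i.e., every complex eigenvalue of A_δ has modulus strictly less than 1. -/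
/-- The matrix (w.r.t. the standard orthonormal bases) of a continuous linear map
between Euclidean spaces. -/
noncomputable def matrixOfCLM {m n : ℕ}
    (T : EuclideanSpace ℝ (Fin m) →L[ℝ] EuclideanSpace ℝ (Fin n)) :
    Matrix (Fin n) (Fin m) ℝ :=
  LinearMap.toMatrix (EuclideanSpace.basisFun (Fin m) ℝ).toBasis
    (EuclideanSpace.basisFun (Fin n) ℝ).toBasis T

/-- A real square matrix is Schur stable if all of its complex eigenvalues lie
strictly inside the unit disk. -/
def SchurStable {n : ℕ} (A : Matrix (Fin n) (Fin n) ℝ) : Prop :=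
  ∀ μ ∈ spectrum ℂ (A.map (algebraMap ℝ ℂ)), ‖μ‖ < 1

/-- A function `γ : ℝ → ℝ` is of class 𝒦∞: continuous, strictly increasing,
zero at zero, and unbounded. -/
def ClassKInf (γ : ℝ → ℝ) : Prop :=
  Continuous γ ∧ StrictMonoOn γ (Set.Ici 0) ∧ γ 0 = 0 ∧
    Filter.Tendsto γ Filter.atTop Filter.atTop

/-- If a real matrix has powers tending to zero entrywise, then it is Schur stable. -/
theorem schurStable_of_tendsto_pow_zero {n : ℕ} {A : Matrix (Fin n) (Fin n) ℝ}
    (hA : ∀ i j, Filter.Tendsto (fun k : ℕ => (A ^ k) i j) Filter.atTop (nhds 0)) :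
    SchurStable A := by
  intro μ hμ
  rw [← Matrix.spectrum_toLin', ← Module.End.hasEigenvalue_iff_mem_spectrum] at hμ
  obtain ⟨z, hz⟩ := hμ.exists_hasEigenvector
  obtain ⟨i, hi⟩ := Function.ne_iff.mp hz.2
  have hpow : ∀ k : ℕ, ∑ j, ((A ^ k) i j : ℂ) * z j = μ ^ k * z i := by
    intro k
    have h := congrFun (hz.pow_apply k) i
    rw [← Matrix.toLin'_pow, ← Matrix.map_pow, Matrix.toLin'_apply] at h
    simpa [Matrix.mulVec, dotProduct] using h
  have hsum : Filter.Tendsto (fun k : ℕ => ∑ j, ((A ^ k) i j : ℂ) * z j)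
      Filter.atTop (nhds (∑ j, ((0 : ℝ) : ℂ) * z j)) :=
    tendsto_finsetSum _ fun j _ =>
      ((Complex.continuous_ofReal.tendsto 0).comp (hA i j)).mul_const (z j)
  simp only [hpow, Complex.ofReal_zero, zero_mul, Finset.sum_const_zero] at hsum
  have hμ0 := hsum.mul_const (z i)⁻¹
  simp only [mul_assoc, mul_inv_cancel₀ hi, mul_one, zero_mul] at hμ0
  exact tendsto_pow_atTop_nhds_zero_iff_norm_lt_one.mp hμ0

/-- The matrix of an operator whose powers tend to zero is Schur stable. -/
theorem schurStable_matrixOfCLM {n : ℕ}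
    {T : EuclideanSpace ℝ (Fin n) →L[ℝ] EuclideanSpace ℝ (Fin n)}
    (hT : Filter.Tendsto (fun k : ℕ => T ^ k) Filter.atTop (nhds 0)) :
    SchurStable (matrixOfCLM T) := by
  refine schurStable_of_tendsto_pow_zero fun i j => ?_
  have hentry : ∀ k : ℕ,
      (matrixOfCLM T ^ k) i j = (T ^ k) (EuclideanSpace.basisFun (Fin n) ℝ j) i := by
    intro k
    rw [matrixOfCLM, LinearMap.toMatrix_pow, LinearMap.toMatrix_apply,
      ← ContinuousLinearMap.toLinearMap_pow]
    simp [Module.End.pow_apply]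
  simp only [hentry]
  have hcont : Continuous fun S : EuclideanSpace ℝ (Fin n) →L[ℝ] EuclideanSpace ℝ (Fin n) =>
      S (EuclideanSpace.basisFun (Fin n) ℝ j) i := by fun_prop
  exact (hcont.tendsto' 0 0 (by simp)).comp hT

/-- If the iterates of a map contract exponentially towards a fixed point, then the powers of its
derivative there tend to zero. -/
theorem HasFDerivAt.tendsto_pow_zero_of_iterate_le {E : Type*} [NormedAddCommGroup E]
    [NormedSpace ℝ E] {g : E → E} {g' : E →L[ℝ] E} {x : E} (hg : HasFDerivAt g g' x)
    (hx : g x = x) {C r : ℝ} (hC : 0 ≤ C) (hr0 : 0 ≤ r) (hr1 : r < 1)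
    (hle : ∀ (k : ℕ) (y : E), ‖g^[k] y - x‖ ≤ C * ‖y - x‖ * r ^ k) :
    Filter.Tendsto (fun k : ℕ => g' ^ k) Filter.atTop (nhds 0) := by
  have hbound : ∀ k : ℕ, ‖g' ^ k‖ ≤ C * r ^ k := fun k =>
    (hg.iterate hx k).le_of_lip' (by positivity) <| Filter.Eventually.of_forall fun y => by
      rw [Function.iterate_fixed hx]
      linarith [hle k y]
  refine squeeze_zero_norm hbound ?_
  simpa using (tendsto_pow_atTop_nhds_zero_of_lt_one hr0 hr1).const_mul C

theorem schur_stability_of_jacobian_at_equilibria_of_deltaISS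
    {n m : ℕ}
    (f : EuclideanSpace ℝ (Fin n) × EuclideanSpace ℝ (Fin m) → EuclideanSpace ℝ (Fin n))
    (U : Set (EuclideanSpace ℝ (Fin m))) (hU : IsCompact U)
    -- f is continuously differentiable
    (hf : ContDiff ℝ 1 f)
    -- x ↦ D_x f(x, u) is Lipschitz continuous in x, uniformly for each fixed input
    (L : NNReal)
    (hLip : ∀ u ∈ U, LipschitzWith L (fun x => fderiv ℝ (fun x' => f (x', u)) x))
    -- δISS with exponential KL bound
    (ρ lam : ℝ) (hρ : 0 < ρ) (hlam0 : 0 < lam) (hlam1 : lam < 1)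
    (γ : ℝ → ℝ) (hγ : ClassKInf γ)
    (hISS : ∀ (xa xb : ℕ → EuclideanSpace ℝ (Fin n)) (ua ub : ℕ → EuclideanSpace ℝ (Fin m)),
      (∀ k, ua k ∈ U) → (∀ k, ub k ∈ U) →
      (∀ k, xa (k + 1) = f (xa k, ua k)) →
      (∀ k, xb (k + 1) = f (xb k, ub k)) →
      ∀ k, ‖xa k - xb k‖ ≤ ρ * ‖xa 0 - xb 0‖ * lam ^ k +
        γ ((Finset.range (k + 1)).sup'
            (Finset.nonempty_range_iff.mpr k.succ_ne_zero) (fun t => ‖ua t - ub t‖))) :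
    -- conclusion: the Jacobian at each equilibrium is Schur stable
    ∀ (xbar : EuclideanSpace ℝ (Fin n)) (ubar : EuclideanSpace ℝ (Fin m)),
      ubar ∈ U → f (xbar, ubar) = xbar →
      SchurStable (matrixOfCLM (fderiv ℝ (fun x => f (x, ubar)) xbar)) := by
  intro xbar ubar hu hfix
  have hdiff : DifferentiableAt ℝ (fun x => f (x, ubar)) xbar :=
    ((hf.differentiable one_ne_zero).comp
      (differentiable_id.prodMk (differentiable_const ubar))).differentiableAt
  refine schurStable_matrixOfCLM
    (hdiff.hasFDerivAt.tendsto_pow_zero_of_iterate_le hfix hρ.le hlam0.le hlam1 fun k y => ?_)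
  have h := hISS (fun k => (fun x => f (x, ubar))^[k] y) (fun _ => xbar) (fun _ => ubar)
    (fun _ => ubar) (fun _ => hu) (fun _ => hu)
    (fun k => Function.iterate_succ_apply' _ k y) (fun _ => hfix.symm) k
  simpa [hγ.2.2.1] using h
end

section
/- Let g : ℝ^n → ℝ^n be Lipschitz continuous with g(0) = 0, and suppose the system δx_{k+1} = g(δx_k) is globally exponentially stable: there exist ρ > 0 and λ ∈ (0,1) such that every trajectory satisfies ‖δx_k‖₂ ≤ ρ ‖δx_0‖₂ λ^k for all k ≥ 0. Then there exist a function V : ℝ^n → ℝ and positive constants c₁, c₂, c₃, c₄ such that for all x, y ∈ ℝ^n: (i) c₁ ‖x‖₂² ≤ V(x) ≤ c₂ ‖x‖₂²; (ii) V(g(x)) − V(x) ≤ −c₃ ‖x‖₂²; (iii) |V(x) − V(y)| ≤ c₄ (‖x‖₂ + ‖y‖₂) ‖x − y‖₂. -/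
/-- The sum of the squared norms along the first `N` points of the trajectory of `g` from `x`. -/
def trajectoryEnergy {E : Type*} [Norm E] (g : E → E) (N : ℕ) (x : E) : ℝ :=
  ∑ k ∈ Finset.range N, ‖g^[k] x‖ ^ 2

theorem trajectoryEnergy_map_sub {E : Type*} [Norm E] (g : E → E) (N : ℕ) (x : E) :
    trajectoryEnergy g N (g x) - trajectoryEnergy g N x = ‖g^[N] x‖ ^ 2 - ‖x‖ ^ 2 := by
  simp only [trajectoryEnergy, ← Function.iterate_succ_apply, ← Finset.sum_sub_distrib]
  exact Finset.sum_range_sub (fun k => ‖g^[k] x‖ ^ 2) N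

theorem norm_sq_le_trajectoryEnergy_succ {E : Type*} [Norm E] (g : E → E) (N : ℕ) (x : E) :
    ‖x‖ ^ 2 ≤ trajectoryEnergy g (N + 1) x :=
  Finset.single_le_sum (f := fun k => ‖g^[k] x‖ ^ 2) (fun _ _ => sq_nonneg _)
    (Finset.mem_range.2 N.succ_pos)

theorem trajectoryEnergy_le {E : Type*} [SeminormedAddCommGroup E] {g : E → E} {b : ℕ → ℝ}
    (hb : ∀ k x, ‖g^[k] x‖ ≤ b k * ‖x‖) (N : ℕ) (x : E) :
    trajectoryEnergy g N x ≤ (∑ k ∈ Finset.range N, b k ^ 2) * ‖x‖ ^ 2 := by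
  rw [trajectoryEnergy, Finset.sum_mul]
  refine Finset.sum_le_sum fun k _ => ?_
  rw [← mul_pow]
  exact pow_le_pow_left₀ (norm_nonneg _) (hb k x) 2

theorem abs_trajectoryEnergy_sub_le {E : Type*} [SeminormedAddCommGroup E] {g : E → E}
    {K : NNReal} (hg : LipschitzWith K g) {b : ℕ → ℝ}
    (hb : ∀ k x, ‖g^[k] x‖ ≤ b k * ‖x‖) (N : ℕ) (x y : E) :
    |trajectoryEnergy g N x - trajectoryEnergy g N y| ≤
      (∑ k ∈ Finset.range N, b k * (K : ℝ) ^ k) * (‖x‖ + ‖y‖) * ‖x - y‖ := by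
  simp only [trajectoryEnergy, ← Finset.sum_sub_distrib, Finset.sum_mul]
  refine (Finset.abs_sum_le_sum_abs _ _).trans (Finset.sum_le_sum fun k _ => ?_)
  have hsum : ‖g^[k] x‖ + ‖g^[k] y‖ ≤ b k * (‖x‖ + ‖y‖) := by
    linarith [hb k x, hb k y]
  have hdiff : |‖g^[k] x‖ - ‖g^[k] y‖| ≤ (K : ℝ) ^ k * ‖x - y‖ :=
    (abs_norm_sub_norm_le _ _).trans (by simpa using (hg.iterate k).norm_sub_le x y)
  calc |‖g^[k] x‖ ^ 2 - ‖g^[k] y‖ ^ 2|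
      = (‖g^[k] x‖ + ‖g^[k] y‖) * |‖g^[k] x‖ - ‖g^[k] y‖| := by
        rw [sq_sub_sq, abs_mul, abs_of_nonneg (by positivity)]
    _ ≤ b k * (‖x‖ + ‖y‖) * ((K : ℝ) ^ k * ‖x - y‖) :=
        mul_le_mul hsum hdiff (abs_nonneg _) (le_trans (by positivity) hsum)
    _ = b k * (K : ℝ) ^ k * (‖x‖ + ‖y‖) * ‖x - y‖ := by ring


theorem converse_lyapunov_of_global_exponential_stability
    {n : ℕ}
    (g : EuclideanSpace ℝ (Fin n) → EuclideanSpace ℝ (Fin n))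
    (K : NNReal) (hgLip : LipschitzWith K g) (hg0 : g 0 = 0)
    -- global exponential stability of δx⁺ = g(δx)
    (ρ lam : ℝ) (hρ : 0 < ρ) (hlam0 : 0 < lam) (hlam1 : lam < 1)
    (hGES : ∀ x : ℕ → EuclideanSpace ℝ (Fin n),
      (∀ k, x (k + 1) = g (x k)) → ∀ k, ‖x k‖ ≤ ρ * ‖x 0‖ * lam ^ k) :
    ∃ (V : EuclideanSpace ℝ (Fin n) → ℝ) (c₁ c₂ c₃ c₄ : ℝ),
      0 < c₁ ∧ 0 < c₂ ∧ 0 < c₃ ∧ 0 < c₄ ∧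
      (∀ x, c₁ * ‖x‖ ^ 2 ≤ V x ∧ V x ≤ c₂ * ‖x‖ ^ 2) ∧
      (∀ x, V (g x) - V x ≤ -c₃ * ‖x‖ ^ 2) ∧
      (∀ x y, |V x - V y| ≤ c₄ * (‖x‖ + ‖y‖) * ‖x - y‖) := by
  have hb : ∀ k x, ‖g^[k] x‖ ≤ ρ * lam ^ k * ‖x‖ := fun k x => by
    have h := hGES (fun k => g^[k] x) (fun k => Function.iterate_succ_apply' g k x) k
    simpa [mul_right_comm] using h
  obtain ⟨N, hN⟩ : ∃ N : ℕ, ρ * lam ^ (N + 1) ≤ 1 / 2 := by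
    obtain ⟨N, hN⟩ := exists_pow_lt_of_lt_one (show 0 < 1 / (2 * ρ) by positivity) hlam1
    refine ⟨N, ?_⟩
    calc ρ * lam ^ (N + 1) ≤ ρ * (1 / (2 * ρ)) := by
          gcongr
          exact (pow_le_pow_of_le_one hlam0.le hlam1.le N.le_succ).trans hN.le
      _ = 1 / 2 := by field_simp
  refine ⟨trajectoryEnergy g (N + 1), 1, ∑ k ∈ Finset.range (N + 1), (ρ * lam ^ k) ^ 2, 3 / 4,
    ∑ k ∈ Finset.range (N + 1), ρ * lam ^ k * (K : ℝ) ^ k, one_pos, ?_, by norm_num, ?_,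
    fun x => ⟨?_, trajectoryEnergy_le hb _ x⟩, fun x => ?_,
    abs_trajectoryEnergy_sub_le hgLip hb _⟩
  · exact Finset.sum_pos (fun k _ => by positivity) Finset.nonempty_range_add_one
  · rw [Finset.sum_range_succ']
    have : 0 ≤ ∑ k ∈ Finset.range N, ρ * lam ^ (k + 1) * (K : ℝ) ^ (k + 1) :=
      Finset.sum_nonneg fun k _ => by positivity
    simpa using add_pos_of_nonneg_of_pos this hρ
  · simpa using norm_sq_le_trajectoryEnergy_succ g N x
  · rw [trajectoryEnergy_map_sub]
    have h : ‖g^[N + 1] x‖ ≤ 1 / 2 * ‖x‖ := (hb _ x).trans (by gcongr)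
    have := pow_le_pow_left₀ (norm_nonneg _) h 2
    rw [mul_pow] at this
    linarith
end
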